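/- arXiv:0911.1222 — 2 statements merged into one kernel-verified Lean document; each statement's English description precedes it below -/
import Mathlib

section
/- Let R = ℂ⟦x,y⟧ (or the ring of convergent power series ℂ{x,y}) and let I = ⟨g,h⟩ be an ideal generated by two elements such that dim_ℂ(R/I) ≥ 3 and ⟨x², x·y², y³⟩ ⊆ I. Then, after a suitable analytic change of coordinates, either I = ⟨x², y²⟩ or I = ⟨x, y³⟩. -/
/- STATEMENT 0: In R = ℂ⟦x,y⟧, if I = ⟨g,h⟩ with dim_ℂ(R/I) ≥ 3 and
⟨x², xy², y³⟩ ⊆ I, then after a suitable change of coordinates (a local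
ℂ-algebra automorphism of R), I = ⟨x², y²⟩ or I = ⟨x, y³⟩. -/

noncomputable section

abbrev R2 : Type := MvPowerSeries (Fin 2) ℂ

noncomputable def Xv : R2 := MvPowerSeries.X 0
noncomputable def Yv : R2 := MvPowerSeries.X 1

open MvPowerSeries

/-- The coefficient of `x ^ i * y ^ j`. -/
def coeffXY (i j : ℕ) : R2 →ₗ[ℂ] ℂ :=
  coeff (Finsupp.single 0 i + Finsupp.single 1 j)

/-- The constant power series. -/
abbrev constXY : ℂ →+* R2 := MvPowerSeries.C

lemma monomial_eq_Xv_mul_Yv (a b : ℕ) :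
    Xv ^ a * Yv ^ b = monomial (Finsupp.single 0 a + Finsupp.single 1 b) (1 : ℂ) := by
  rw [Xv, Yv, X_pow_eq, X_pow_eq, monomial_mul_monomial, one_mul]

lemma exponent_eq_iff (i j a b : ℕ) :
    (Finsupp.single (0 : Fin 2) i + Finsupp.single 1 j =
      Finsupp.single 0 a + Finsupp.single 1 b) ↔ i = a ∧ j = b := by
  simp [Finsupp.ext_iff, Fin.forall_fin_two, Finsupp.single_apply]

lemma coeffXY_monomial (i j a b : ℕ) :
    coeffXY i j (Xv ^ a * Yv ^ b) = if i = a ∧ j = b then 1 else 0 := by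
  classical
  rw [monomial_eq_Xv_mul_Yv, coeffXY, coeff_monomial]
  simp only [exponent_eq_iff]

lemma coeffXY_C_mul (i j : ℕ) (a : ℂ) (f : R2) :
    coeffXY i j (constXY a * f) = a * coeffXY i j f :=
  coeff_C_mul _ _ _

lemma coeffXY_succ_Xv_mul (i j : ℕ) (f : R2) :
    coeffXY (i + 1) j (Xv * f) = coeffXY i j f := by
  have : (Finsupp.single (0 : Fin 2) (i + 1) + Finsupp.single 1 j) =
      Finsupp.single 0 1 + (Finsupp.single 0 i + Finsupp.single 1 j) := by
    rw [Finsupp.single_add]; abel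
  rw [coeffXY, this, Xv, X, coeff_add_monomial_mul, one_mul, coeffXY]

lemma coeffXY_zero_Xv_mul (j : ℕ) (f : R2) : coeffXY 0 j (Xv * f) = 0 :=
  X_dvd_iff.1 (Dvd.intro f rfl) _ (by simp)

lemma coeffXY_succ_Yv_mul (i j : ℕ) (f : R2) :
    coeffXY i (j + 1) (Yv * f) = coeffXY i j f := by
  have : (Finsupp.single (0 : Fin 2) i + Finsupp.single 1 (j + 1)) =
      Finsupp.single 1 1 + (Finsupp.single 0 i + Finsupp.single 1 j) := by
    rw [Finsupp.single_add]; abel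
  rw [coeffXY, this, Yv, X, coeff_add_monomial_mul, one_mul, coeffXY]

lemma coeffXY_zero_Yv_mul (i : ℕ) (f : R2) : coeffXY i 0 (Yv * f) = 0 :=
  X_dvd_iff.1 (Dvd.intro f rfl) _ (by simp)

lemma exists_eq_const_add (f : R2) :
    ∃ a b : R2, f = constXY (coeffXY 0 0 f) + Xv * a + Yv * b := by
  classical
  let g : R2 := fun m => if m 0 = 0 then coeff m f else 0
  have hg : ∀ m, coeff m g = if m 0 = 0 then coeff m f else 0 := fun m => rfl
  obtain ⟨a, ha⟩ : Xv ∣ f - g := by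
    refine X_dvd_iff.2 fun m hm => ?_
    rw [map_sub, hg, if_pos hm, sub_self]
  obtain ⟨b, hb⟩ : Yv ∣ g - constXY (coeffXY 0 0 f) := by
    refine X_dvd_iff.2 fun m hm => ?_
    rw [map_sub, hg, coeff_C]
    by_cases h0 : m 0 = 0
    · have : m = 0 := by
        ext i; fin_cases i <;> simp_all
      simp [this, coeffXY]
    · have : m ≠ 0 := by rintro rfl; simp at h0
      simp [h0, this]
  exact ⟨a, b, by linear_combination ha + hb⟩

lemma coeffXY_const_zero (a : ℂ) : coeffXY 0 0 (constXY a) = a := by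
  simp [coeffXY]

lemma coeffXY_const (i j : ℕ) (h : ¬(i = 0 ∧ j = 0)) (a : ℂ) : coeffXY i j (constXY a) = 0 := by
  have := coeffXY_monomial i j 0 0
  rw [if_neg h, pow_zero, pow_zero, one_mul] at this
  have h2 := coeffXY_C_mul i j a 1
  rwa [this, mul_one, mul_zero] at h2

/-- Every power series is congruent to a combination of `1, x, y, xy, y²`. -/
lemma sub_normalForm_mem (f : R2) :
    f - (constXY (coeffXY 0 0 f) + constXY (coeffXY 1 0 f) * Xv + constXY (coeffXY 0 1 f) * Yv
      + constXY (coeffXY 1 1 f) * (Xv * Yv) + constXY (coeffXY 0 2 f) * Yv ^ 2) ∈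
      Ideal.span {Xv ^ 2, Xv * Yv ^ 2, Yv ^ 3} := by
  obtain ⟨a, b, hf⟩ := exists_eq_const_add f
  obtain ⟨a1, a2, ha⟩ := exists_eq_const_add a
  obtain ⟨b1, b2, hb⟩ := exists_eq_const_add b
  obtain ⟨a3, a4, ha2⟩ := exists_eq_const_add a2
  obtain ⟨b3, b4, hb1⟩ := exists_eq_const_add b1
  obtain ⟨b5, b6, hb2⟩ := exists_eq_const_add b2
  have h10 : coeffXY 1 0 f = coeffXY 0 0 a := by
    rw [hf, map_add, map_add, coeffXY_succ_Xv_mul, coeffXY_zero_Yv_mul,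
      coeffXY_const _ _ (by simp)]; ring
  have h01 : coeffXY 0 1 f = coeffXY 0 0 b := by
    rw [hf, map_add, map_add, coeffXY_succ_Yv_mul, coeffXY_zero_Xv_mul,
      coeffXY_const _ _ (by simp)]; ring
  have h11 : coeffXY 1 1 f = coeffXY 0 0 a2 + coeffXY 0 0 b1 := by
    have e1 : coeffXY 0 1 a = coeffXY 0 0 a2 := by
      rw [ha, map_add, map_add, coeffXY_succ_Yv_mul, coeffXY_zero_Xv_mul,
        coeffXY_const _ _ (by simp)]; ring
    have e2 : coeffXY 1 0 b = coeffXY 0 0 b1 := by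
      rw [hb, map_add, map_add, coeffXY_succ_Xv_mul, coeffXY_zero_Yv_mul,
        coeffXY_const _ _ (by simp)]; ring
    rw [← e1, ← e2, hf, map_add, map_add, coeffXY_succ_Yv_mul, coeffXY_succ_Xv_mul,
      coeffXY_const _ _ (by simp)]; ring
  have h02 : coeffXY 0 2 f = coeffXY 0 0 b2 := by
    have e2 : coeffXY 0 1 b = coeffXY 0 0 b2 := by
      rw [hb, map_add, map_add, coeffXY_succ_Yv_mul, coeffXY_zero_Xv_mul,
        coeffXY_const _ _ (by simp)]; ring
    rw [← e2, hf, map_add, map_add, coeffXY_succ_Yv_mul, coeffXY_zero_Xv_mul,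
      coeffXY_const _ _ (by simp)]; ring
  rw [h10, h01, h11, h02, map_add]
  have hxx : Xv ^ 2 ∈ Ideal.span {Xv ^ 2, Xv * Yv ^ 2, Yv ^ 3} :=
    Ideal.subset_span (by simp)
  have hxyy : Xv * Yv ^ 2 ∈ Ideal.span {Xv ^ 2, Xv * Yv ^ 2, Yv ^ 3} :=
    Ideal.subset_span (by simp)
  have hyyy : Yv ^ 3 ∈ Ideal.span {Xv ^ 2, Xv * Yv ^ 2, Yv ^ 3} :=
    Ideal.subset_span (by simp)
  convert add_mem (add_mem (Ideal.mul_mem_left _ (a1 + Yv * a3 + Yv * b3) hxx)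
    (Ideal.mul_mem_left _ (a4 + b4 + b5) hxyy)) (Ideal.mul_mem_left _ b6 hyyy) using 1
  linear_combination hf + Xv * ha + Yv * hb + Xv * Yv * ha2 + Xv * Yv * hb1 + Yv ^ 2 * hb2

lemma mk_eq_normalForm {I : Ideal R2}
    (hsub : Ideal.span {Xv ^ 2, Xv * Yv ^ 2, Yv ^ 3} ≤ I) (f : R2) :
    Ideal.Quotient.mk I f = Ideal.Quotient.mk I (constXY (coeffXY 0 0 f)
      + constXY (coeffXY 1 0 f) * Xv + constXY (coeffXY 0 1 f) * Yv
      + constXY (coeffXY 1 1 f) * (Xv * Yv) + constXY (coeffXY 0 2 f) * Yv ^ 2) :=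
  Ideal.Quotient.eq.2 (hsub (sub_normalForm_mem f))

lemma finrank_quotient_le_two {I : Ideal R2} (p q : R2)
    (H : ∀ f, ∃ a b : ℂ, f - (constXY a * p + constXY b * q) ∈ I) :
    Module.finrank ℂ (R2 ⧸ I) ≤ 2 := by
  have htop : Submodule.span ℂ (Set.range ![Ideal.Quotient.mk I p, Ideal.Quotient.mk I q]) = ⊤ := by
    rw [eq_top_iff]
    rintro z -
    obtain ⟨f, rfl⟩ := Ideal.Quotient.mk_surjective z
    obtain ⟨a, b, h⟩ := H f
    rw [Ideal.Quotient.eq.2 h]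
    simp only [Matrix.range_cons, Matrix.range_empty, Set.union_empty, Set.singleton_union]
    rw [Submodule.mem_span_pair]
    refine ⟨a, b, ?_⟩
    rw [map_add, ← smul_eq_C_mul, ← smul_eq_C_mul]
    rfl
  have := finrank_range_le_card (R := ℂ) ![Ideal.Quotient.mk I p, Ideal.Quotient.mk I q]
  rwa [Set.finrank, htop, finrank_top, Fintype.card_fin] at this

lemma coeffXY_mul_of_mem {I : Ideal R2} (i j : ℕ)
    (hx : ∀ k, i = k + 1 → ∀ g ∈ I, coeffXY k j g = 0)
    (hy : ∀ k, j = k + 1 → ∀ g ∈ I, coeffXY i k g = 0) (r f : R2) (hf : f ∈ I) :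
    coeffXY i j (r * f) = coeffXY 0 0 r * coeffXY i j f := by
  obtain ⟨a, b, hr⟩ := exists_eq_const_add r
  have h1 : coeffXY i j (Xv * (a * f)) = 0 := by
    cases i with
    | zero => exact coeffXY_zero_Xv_mul _ _
    | succ k => rw [coeffXY_succ_Xv_mul]; exact hx k rfl _ (I.mul_mem_left _ hf)
  have h2 : coeffXY i j (Yv * (b * f)) = 0 := by
    cases j with
    | zero => exact coeffXY_zero_Yv_mul _ _
    | succ k => rw [coeffXY_succ_Yv_mul]; exact hy k rfl _ (I.mul_mem_left _ hf)
  have : r * f = constXY (coeffXY 0 0 r) * f + Xv * (a * f) + Yv * (b * f) := by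
    linear_combination f * hr
  rw [this, map_add, map_add, h1, h2, coeffXY_C_mul, add_zero, add_zero]

/-- An ideal containing three distinct monomials, all of whose elements vanish in the degrees
immediately below these monomials, is not generated by two elements. -/
lemma not_generated_by_two {I : Ideal R2} (g h : R2) (hI : I = Ideal.span {g, h})
    (e : Fin 3 → ℕ × ℕ) (he : Function.Injective e)
    (hx : ∀ i k, (e i).1 = k + 1 → ∀ f ∈ I, coeffXY k (e i).2 f = 0)
    (hy : ∀ i k, (e i).2 = k + 1 → ∀ f ∈ I, coeffXY (e i).1 k f = 0)
    (hp : ∀ j, Xv ^ (e j).1 * Yv ^ (e j).2 ∈ I) : False := by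
  have hL (i) (r f : R2) (hf : f ∈ I) := coeffXY_mul_of_mem _ _ (hx i) (hy i) r f hf
  have hLp (i j) : coeffXY (e i).1 (e i).2 (Xv ^ (e j).1 * Yv ^ (e j).2) =
      if i = j then 1 else 0 := by
    simp only [coeffXY_monomial, ← Prod.ext_iff, he.eq_iff]
  have hg : g ∈ I := hI ▸ Ideal.subset_span (by simp)
  have hh : h ∈ I := hI ▸ Ideal.subset_span (by simp)
  have key : ∀ j, ∃ a b : ℂ, ∀ i, (if i = j then (1 : ℂ) else 0) =
      a * coeffXY (e i).1 (e i).2 g + b * coeffXY (e i).1 (e i).2 h := by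
    intro j
    have hj := hp j
    rw [hI, Ideal.mem_span_pair] at hj
    obtain ⟨a, b, hab⟩ := hj
    refine ⟨coeffXY 0 0 a, coeffXY 0 0 b, fun i => ?_⟩
    rw [← hLp, ← hab, map_add, hL i a g hg, hL i b h hh]
  choose a b hab using key
  have hdet : (Matrix.of fun i j => a j * coeffXY (e i).1 (e i).2 g +
      b j * coeffXY (e i).1 (e i).2 h).det = 0 := by
    rw [Matrix.det_fin_three]; simp only [Matrix.of_apply]; ring
  have hone : (Matrix.of fun i j => a j * coeffXY (e i).1 (e i).2 g +
      b j * coeffXY (e i).1 (e i).2 h) = (1 : Matrix (Fin 3) (Fin 3) ℂ) := by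
    ext i j; rw [Matrix.of_apply, ← hab, Matrix.one_apply]
  rw [hone, Matrix.det_one] at hdet
  exact one_ne_zero hdet

/-- Substitutions that are mutually inverse on the variables give an automorphism. -/
lemma exists_algEquiv (u v : Fin 2 → R2) (hu : HasSubst u) (hv : HasSubst v)
    (huv : ∀ s, subst v (u s) = (X s : R2)) (hvu : ∀ s, subst u (v s) = (X s : R2)) :
    ∃ φ : R2 ≃ₐ[ℂ] R2, ∀ s, φ (X s) = u s := by
  refine ⟨AlgEquiv.ofAlgHom (substAlgHom hu) (substAlgHom hv) ?_ ?_, fun s => ?_⟩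
  · ext1 f
    simp only [AlgHom.comp_apply, substAlgHom_apply, AlgHom.id_apply]
    rw [subst_comp_subst_apply hv hu]
    simp only [hvu, subst_self, id]
  · ext1 f
    simp only [AlgHom.comp_apply, substAlgHom_apply, AlgHom.id_apply]
    rw [subst_comp_subst_apply hu hv]
    simp only [huv, subst_self, id]
  · exact substAlgHom_X hu s

lemma constXY_eq_smul_one (a : ℂ) : constXY a = a • (1 : R2) := by
  rw [smul_eq_C_mul, mul_one]

lemma exists_shear_x (d : ℂ) :
    ∃ φ : R2 ≃ₐ[ℂ] R2, φ Xv = Xv - constXY d * Yv ^ 2 ∧ φ Yv = Yv := by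
  have hs (d : ℂ) : HasSubst ![Xv - constXY d * Yv ^ 2, Yv] :=
    hasSubst_of_constantCoeff_zero (by simp [Fin.forall_fin_two, Xv, Yv])
  have hinv (d : ℂ) (s) : subst ![Xv - constXY d * Yv ^ 2, Yv]
      (![Xv - constXY (-d) * Yv ^ 2, Yv] s) = (X s : R2) := by
    have hX : subst ![Xv - constXY d * Yv ^ 2, Yv] Xv = Xv - constXY d * Yv ^ 2 :=
      subst_X (hs d) 0
    have hY : subst ![Xv - constXY d * Yv ^ 2, Yv] Yv = Yv := subst_X (hs d) 1
    fin_cases s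
    · change subst _ (Xv - constXY (-d) * Yv ^ 2) = Xv
      rw [subst_sub (hs d), ← smul_eq_C_mul (Yv ^ 2) (-d), subst_smul (hs d), subst_pow (hs d),
        hX, hY, smul_eq_C_mul, map_neg]
      ring
    · exact hY
  obtain ⟨φ, hφ⟩ := exists_algEquiv _ _ (hs d) (hs (-d))
    (fun s => by simpa using hinv (-d) s) (hinv d)
  exact ⟨φ, hφ 0, hφ 1⟩

lemma exists_shear_y (d : ℂ) :
    ∃ φ : R2 ≃ₐ[ℂ] R2, φ Xv = Xv ∧ φ Yv = Yv - constXY d * Xv := by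
  have hs (d : ℂ) : HasSubst ![Xv, Yv - constXY d * Xv] :=
    hasSubst_of_constantCoeff_zero (by simp [Fin.forall_fin_two, Xv, Yv])
  have hinv (d : ℂ) (s) : subst ![Xv, Yv - constXY d * Xv]
      (![Xv, Yv - constXY (-d) * Xv] s) = (X s : R2) := by
    have hX : subst ![Xv, Yv - constXY d * Xv] Xv = Xv := subst_X (hs d) 0
    have hY : subst ![Xv, Yv - constXY d * Xv] Yv = Yv - constXY d * Xv := subst_X (hs d) 1
    fin_cases s
    · exact hX
    · change subst _ (Yv - constXY (-d) * Xv) = Yv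
      rw [subst_sub (hs d), ← smul_eq_C_mul Xv (-d), subst_smul (hs d),
        hX, hY, smul_eq_C_mul, map_neg]
      ring
  obtain ⟨φ, hφ⟩ := exists_algEquiv _ _ (hs d) (hs (-d))
    (fun s => by simpa using hinv (-d) s) (hinv d)
  exact ⟨φ, hφ 0, hφ 1⟩

lemma finrank_eq_zero_of_coeffXY_ne_zero {I : Ideal R2} {f : R2} (hf : f ∈ I)
    (h : coeffXY 0 0 f ≠ 0) : Module.finrank ℂ (R2 ⧸ I) = 0 := by
  have hu : IsUnit f := by
    rw [isUnit_iff_constantCoeff, isUnit_iff_ne_zero]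
    simpa [coeffXY] using h
  have : Subsingleton (R2 ⧸ I) :=
    Ideal.Quotient.subsingleton_iff.2 (Ideal.eq_top_of_isUnit_mem _ hf hu)
  exact Module.finrank_zero_of_subsingleton

lemma mk_relations {I : Ideal R2} (hsub : Ideal.span {Xv ^ 2, Xv * Yv ^ 2, Yv ^ 3} ≤ I) :
    Ideal.Quotient.mk I Xv ^ 2 = 0 ∧ Ideal.Quotient.mk I Xv * Ideal.Quotient.mk I Yv ^ 2 = 0 ∧
      Ideal.Quotient.mk I Yv ^ 3 = 0 := by
  simp only [← map_pow, ← map_mul, Ideal.Quotient.eq_zero_iff_mem]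
  exact ⟨hsub (Ideal.subset_span (by simp)), hsub (Ideal.subset_span (by simp)),
    hsub (Ideal.subset_span (by simp))⟩

lemma mk_const_mul_inv (I : Ideal R2) {c : ℂ} (hc : c ≠ 0) :
    Ideal.Quotient.mk I (constXY c) * Ideal.Quotient.mk I (constXY c⁻¹) = 1 := by
  rw [← map_mul, ← map_mul, mul_inv_cancel₀ hc, map_one, map_one]

lemma finrank_le_two_of_coeffXY_zero_one_ne_zero {I : Ideal R2}
    (hsub : Ideal.span {Xv ^ 2, Xv * Yv ^ 2, Yv ^ 3} ≤ I) {f : R2} (hf : f ∈ I)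
    (h0 : coeffXY 0 0 f = 0) (h : coeffXY 0 1 f ≠ 0) :
    Module.finrank ℂ (R2 ⧸ I) ≤ 2 := by
  obtain ⟨hxx, hxyy, hyyy⟩ := mk_relations hsub
  have hinv := mk_const_mul_inv I h
  have hf0 := Ideal.Quotient.eq_zero_iff_mem.2 hf
  rw [mk_eq_normalForm hsub, h0] at hf0
  simp only [map_add, map_mul, map_pow, map_zero, zero_add] at hf0
  generalize coeffXY 0 1 f = β at *
  generalize coeffXY 1 0 f = α at *
  generalize coeffXY 1 1 f = γ at *
  generalize coeffXY 0 2 f = δ at *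
  refine finrank_quotient_le_two 1 Xv fun g =>
    ⟨coeffXY 0 0 g, coeffXY 1 0 g - coeffXY 0 1 g * α * β⁻¹, ?_⟩
  rw [← Ideal.Quotient.eq, mk_eq_normalForm hsub]
  simp only [map_add, map_sub, map_mul, map_pow, map_one]
  generalize Ideal.Quotient.mk I Xv = x at *
  generalize Ideal.Quotient.mk I Yv = y at *
  generalize Ideal.Quotient.mk I (constXY β) = b at *
  generalize Ideal.Quotient.mk I (constXY β⁻¹) = b' at *
  generalize Ideal.Quotient.mk I (constXY α) = a at *
  generalize Ideal.Quotient.mk I (constXY γ) = c at *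
  generalize Ideal.Quotient.mk I (constXY δ) = d at *
  have hxy : x * y = 0 := by
    linear_combination b' * x * hf0 - x * y * hinv - b' * (a + c * y) * hxx - b' * d * hxyy
  have hyy : y ^ 2 = 0 := by
    linear_combination b' * y * hf0 - y ^ 2 * hinv - b' * (a + c * y) * hxy - b' * d * hyyy
  have hy : y = - a * b' * x := by
    linear_combination b' * hf0 - y * hinv - b' * c * hxy - b' * d * hyy
  rw [hxy, hyy]
  linear_combination Ideal.Quotient.mk I (constXY (coeffXY 0 1 g)) * hy

/-- If some element of `I` has order one, `I` is generated by a smooth germ and `y³`. -/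
lemma eq_span_of_coeffXY_one_zero_ne_zero {I : Ideal R2}
    (hsub : Ideal.span {Xv ^ 2, Xv * Yv ^ 2, Yv ^ 3} ≤ I)
    (hdim : 3 ≤ Module.finrank ℂ (R2 ⧸ I))
    (h00 : ∀ g ∈ I, coeffXY 0 0 g = 0) (h01 : ∀ g ∈ I, coeffXY 0 1 g = 0)
    {f : R2} (hf : f ∈ I) (h : coeffXY 1 0 f ≠ 0) :
    ∃ d : ℂ, I = Ideal.span {Xv + constXY d * Yv ^ 2, Yv ^ 3} := by
  obtain ⟨hxx, hxyy, hyyy⟩ := mk_relations hsub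
  have hinv := mk_const_mul_inv I h
  have hf0 := Ideal.Quotient.eq_zero_iff_mem.2 hf
  rw [mk_eq_normalForm hsub, h00 f hf, h01 f hf] at hf0
  simp only [map_add, map_mul, map_pow, map_zero, zero_add, zero_mul, add_zero] at hf0
  generalize coeffXY 1 0 f = α at *
  generalize coeffXY 1 1 f = γ at *
  generalize coeffXY 0 2 f = δ at *
  have hxy : Ideal.Quotient.mk I Xv * Ideal.Quotient.mk I Yv = 0 := by
    generalize Ideal.Quotient.mk I Xv = x at *
    generalize Ideal.Quotient.mk I Yv = y at *
    generalize Ideal.Quotient.mk I (constXY α) = a at *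
    generalize Ideal.Quotient.mk I (constXY α⁻¹) = a' at *
    generalize Ideal.Quotient.mk I (constXY γ) = c at *
    generalize Ideal.Quotient.mk I (constXY δ) = d at *
    linear_combination a' * y * hf0 - x * y * hinv - a' * c * hxyy - a' * d * hyyy
  have hx : Ideal.Quotient.mk I Xv +
      Ideal.Quotient.mk I (constXY (δ * α⁻¹)) * Ideal.Quotient.mk I Yv ^ 2 = 0 := by
    rw [map_mul, map_mul]
    linear_combination Ideal.Quotient.mk I (constXY α⁻¹) * hf0 - Ideal.Quotient.mk I Xv * hinv -
      Ideal.Quotient.mk I (constXY α⁻¹) * Ideal.Quotient.mk I (constXY γ) * hxy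
  generalize δ * α⁻¹ = e at hx
  clear hf0 hinv
  refine ⟨e, le_antisymm (fun g hg => ?_) ?_⟩
  · have hc : coeffXY 0 2 g = e * coeffXY 1 0 g := by
      by_contra hne
      have hinv := mk_const_mul_inv I (sub_ne_zero.2 hne)
      have hg0 := Ideal.Quotient.eq_zero_iff_mem.2 hg
      rw [mk_eq_normalForm hsub, h00 g hg, h01 g hg] at hg0
      simp only [map_add, map_sub, map_mul, map_pow, map_zero, zero_add, zero_mul,
        add_zero] at hg0 hinv
      have hyy : Ideal.Quotient.mk I Yv ^ 2 = 0 := by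
        linear_combination - Ideal.Quotient.mk I Yv ^ 2 * hinv +
          Ideal.Quotient.mk I (constXY (coeffXY 0 2 g - e * coeffXY 1 0 g)⁻¹) *
          (hg0 - Ideal.Quotient.mk I (constXY (coeffXY 1 0 g)) * hx -
            Ideal.Quotient.mk I (constXY (coeffXY 1 1 g)) * hxy)
      rw [hyy, mul_zero, add_zero] at hx
      have := finrank_quotient_le_two (I := I) 1 Yv fun k =>
        ⟨coeffXY 0 0 k, coeffXY 0 1 k, by
          rw [← Ideal.Quotient.eq, mk_eq_normalForm hsub]
          simp only [map_add, map_mul, map_pow, map_one, hyy, hx]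
          ring⟩
      omega
    set K := Ideal.span {Xv + constXY e * Yv ^ 2, Yv ^ 3}
    have k1 : Ideal.Quotient.mk K Xv +
        Ideal.Quotient.mk K (constXY e) * Ideal.Quotient.mk K Yv ^ 2 = 0 := by
      simp only [← map_pow, ← map_mul, ← map_add, Ideal.Quotient.eq_zero_iff_mem]
      exact Ideal.subset_span (by simp)
    have k2 : Ideal.Quotient.mk K Yv ^ 3 = 0 := by
      simp only [← map_pow, Ideal.Quotient.eq_zero_iff_mem]
      exact Ideal.subset_span (by simp)
    have kxy : Ideal.Quotient.mk K Xv * Ideal.Quotient.mk K Yv = 0 := by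
      linear_combination Ideal.Quotient.mk K Yv * k1 - Ideal.Quotient.mk K (constXY e) * k2
    have hJK : Ideal.span {Xv ^ 2, Xv * Yv ^ 2, Yv ^ 3} ≤ K := by
      rw [Ideal.span_le]
      rintro z (rfl | rfl | rfl) <;>
        simp only [SetLike.mem_coe, ← Ideal.Quotient.eq_zero_iff_mem, map_mul, map_pow]
      · linear_combination Ideal.Quotient.mk K Xv * k1 -
          Ideal.Quotient.mk K (constXY e) * Ideal.Quotient.mk K Yv * kxy
      · linear_combination Ideal.Quotient.mk K Yv * kxy
      · exact k2
    rw [← Ideal.Quotient.eq_zero_iff_mem, mk_eq_normalForm hJK, hc, h00 g hg, h01 g hg]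
    simp only [map_add, map_mul, map_pow, map_zero]
    linear_combination Ideal.Quotient.mk K (constXY (coeffXY 1 0 g)) * k1 +
      Ideal.Quotient.mk K (constXY (coeffXY 1 1 g)) * kxy
  · rw [Ideal.span_le]
    rintro z (rfl | rfl)
    · rw [SetLike.mem_coe, ← Ideal.Quotient.eq_zero_iff_mem]
      simpa only [map_add, map_mul, map_pow] using hx
    · exact hsub (Ideal.subset_span (by simp))

lemma eq_span_of_coeffXY_zero_two_ne_zero (g h : R2) {I : Ideal R2}
    (hI : I = Ideal.span {g, h})
    (hsub : Ideal.span {Xv ^ 2, Xv * Yv ^ 2, Yv ^ 3} ≤ I)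
    (h00 : ∀ g ∈ I, coeffXY 0 0 g = 0) (h01 : ∀ g ∈ I, coeffXY 0 1 g = 0)
    (h10 : ∀ g ∈ I, coeffXY 1 0 g = 0)
    {f : R2} (hf : f ∈ I) (h02 : coeffXY 0 2 f ≠ 0) :
    ∃ e : ℂ, I = Ideal.span {Xv ^ 2, Yv ^ 2 + constXY e * (Xv * Yv)} := by
  have hinv := mk_const_mul_inv I h02
  have hf0 := Ideal.Quotient.eq_zero_iff_mem.2 hf
  rw [mk_eq_normalForm hsub, h00 f hf, h01 f hf, h10 f hf] at hf0
  simp only [map_add, map_mul, map_pow, map_zero, zero_add, zero_mul, add_zero] at hf0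
  generalize coeffXY 1 1 f = γ at *
  generalize coeffXY 0 2 f = δ at *
  have hyy : Ideal.Quotient.mk I Yv ^ 2 + Ideal.Quotient.mk I (constXY (γ * δ⁻¹)) *
      (Ideal.Quotient.mk I Xv * Ideal.Quotient.mk I Yv) = 0 := by
    rw [map_mul, map_mul]
    linear_combination Ideal.Quotient.mk I (constXY δ⁻¹) * hf0 - Ideal.Quotient.mk I Yv ^ 2 * hinv
  generalize γ * δ⁻¹ = e at hyy
  clear hf0 hinv
  refine ⟨e, le_antisymm (fun k hk => ?_) ?_⟩
  · have hc : coeffXY 1 1 k = coeffXY 0 2 k * e := by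
      by_contra hne
      have hinv := mk_const_mul_inv I (sub_ne_zero.2 hne)
      have hk0 := Ideal.Quotient.eq_zero_iff_mem.2 hk
      rw [mk_eq_normalForm hsub, h00 k hk, h01 k hk, h10 k hk] at hk0
      simp only [map_add, map_sub, map_mul, map_pow, map_zero, zero_add, zero_mul,
        add_zero] at hk0 hinv
      have hxy : Ideal.Quotient.mk I Xv * Ideal.Quotient.mk I Yv = 0 := by
        linear_combination - Ideal.Quotient.mk I Xv * Ideal.Quotient.mk I Yv * hinv +
          Ideal.Quotient.mk I (constXY (coeffXY 1 1 k - coeffXY 0 2 k * e)⁻¹) *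
          (hk0 - Ideal.Quotient.mk I (constXY (coeffXY 0 2 k)) * hyy)
      rw [hxy, mul_zero, add_zero, ← map_pow, Ideal.Quotient.eq_zero_iff_mem] at hyy
      rw [← map_mul, Ideal.Quotient.eq_zero_iff_mem] at hxy
      refine not_generated_by_two g h hI ![(2, 0), (1, 1), (0, 2)] (by decide) ?_ ?_ ?_
      · intro i k hk f hf
        fin_cases i <;> simp at hk <;> subst hk <;> simp_all
      · intro i k hk f hf
        fin_cases i <;> simp at hk <;> subst hk <;> simp_all
      · intro j
        fin_cases j
        · simpa using hsub (Ideal.subset_span (by simp))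
        · simpa using hxy
        · simpa using hyy
    set K := Ideal.span {Xv ^ 2, Yv ^ 2 + constXY e * (Xv * Yv)}
    have k1 : Ideal.Quotient.mk K Yv ^ 2 + Ideal.Quotient.mk K (constXY e) *
        (Ideal.Quotient.mk K Xv * Ideal.Quotient.mk K Yv) = 0 := by
      simp only [← map_pow, ← map_mul, ← map_add, Ideal.Quotient.eq_zero_iff_mem]
      exact Ideal.subset_span (by simp)
    have k2 : Ideal.Quotient.mk K Xv ^ 2 = 0 := by
      simp only [← map_pow, Ideal.Quotient.eq_zero_iff_mem]
      exact Ideal.subset_span (by simp)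
    have k3 : Ideal.Quotient.mk K Xv * Ideal.Quotient.mk K Yv ^ 2 = 0 := by
      linear_combination Ideal.Quotient.mk K Xv * k1 -
        Ideal.Quotient.mk K (constXY e) * Ideal.Quotient.mk K Yv * k2
    have hJK : Ideal.span {Xv ^ 2, Xv * Yv ^ 2, Yv ^ 3} ≤ K := by
      rw [Ideal.span_le]
      rintro z (rfl | rfl | rfl) <;>
        simp only [SetLike.mem_coe, ← Ideal.Quotient.eq_zero_iff_mem, map_mul, map_pow]
      · exact k2
      · exact k3
      · linear_combination Ideal.Quotient.mk K Yv * k1 - Ideal.Quotient.mk K (constXY e) * k3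
    rw [← Ideal.Quotient.eq_zero_iff_mem, mk_eq_normalForm hJK, hc, h00 k hk, h01 k hk, h10 k hk]
    simp only [map_add, map_mul, map_pow, map_zero]
    linear_combination Ideal.Quotient.mk K (constXY (coeffXY 0 2 k)) * k1
  · rw [Ideal.span_le]
    rintro z (rfl | rfl)
    · exact hsub (Ideal.subset_span (by simp))
    · rw [SetLike.mem_coe, ← Ideal.Quotient.eq_zero_iff_mem]
      simpa only [map_add, map_mul, map_pow] using hyy

lemma exists_coeffXY_zero_two_ne_zero (g h : R2) {I : Ideal R2}
    (hI : I = Ideal.span {g, h})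
    (hsub : Ideal.span {Xv ^ 2, Xv * Yv ^ 2, Yv ^ 3} ≤ I)
    (h00 : ∀ g ∈ I, coeffXY 0 0 g = 0) (h01 : ∀ g ∈ I, coeffXY 0 1 g = 0)
    (h10 : ∀ g ∈ I, coeffXY 1 0 g = 0) : ∃ f ∈ I, coeffXY 0 2 f ≠ 0 := by
  by_contra! h02
  have hxx : Xv ^ 2 ∈ I := hsub (Ideal.subset_span (by simp))
  have hxyy : Xv * Yv ^ 2 ∈ I := hsub (Ideal.subset_span (by simp))
  have hyyy : Yv ^ 3 ∈ I := hsub (Ideal.subset_span (by simp))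
  by_cases h11 : ∀ f ∈ I, coeffXY 1 1 f = 0
  · refine not_generated_by_two g h hI ![(2, 0), (1, 2), (0, 3)] (by decide) ?_ ?_ ?_
    · intro i k hk f hf
      fin_cases i <;> simp at hk <;> subst hk <;> simp_all
    · intro i k hk f hf
      fin_cases i <;> simp at hk <;> subst hk <;> simp_all
    · intro j
      fin_cases j <;> simpa
  · push Not at h11
    obtain ⟨f, hf, h11⟩ := h11
    have hxy : Xv * Yv ∈ I := by
      have hinv := mk_const_mul_inv I h11
      have hf0 := Ideal.Quotient.eq_zero_iff_mem.2 hf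
      rw [mk_eq_normalForm hsub, h00 f hf, h01 f hf, h10 f hf, h02 f hf] at hf0
      simp only [map_mul, map_zero, zero_add, zero_mul, add_zero] at hf0
      rw [← Ideal.Quotient.eq_zero_iff_mem, map_mul]
      linear_combination Ideal.Quotient.mk I (constXY (coeffXY 1 1 f)⁻¹) * hf0 -
        Ideal.Quotient.mk I Xv * Ideal.Quotient.mk I Yv * hinv
    refine not_generated_by_two g h hI ![(2, 0), (1, 1), (0, 3)] (by decide) ?_ ?_ ?_
    · intro i k hk f hf
      fin_cases i <;> simp at hk <;> subst hk <;> simp_all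
    · intro i k hk f hf
      fin_cases i <;> simp at hk <;> subst hk <;> simp_all
    · intro j
      fin_cases j <;> simpa

theorem statement0 (g h : R2) (I : Ideal R2)
    (hI : I = Ideal.span {g, h})
    (hdim : 3 ≤ Module.finrank ℂ (R2 ⧸ I))
    (hsub : Ideal.span {Xv ^ 2, Xv * Yv ^ 2, Yv ^ 3} ≤ I) :
    ∃ φ : R2 ≃ₐ[ℂ] R2,
      Ideal.map (φ : R2 →+* R2) I = Ideal.span {Xv ^ 2, Yv ^ 2} ∨
      Ideal.map (φ : R2 →+* R2) I = Ideal.span {Xv, Yv ^ 3} := by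
  have hC (φ : R2 ≃ₐ[ℂ] R2) (c : ℂ) : φ (constXY c) = constXY c := by
    rw [constXY_eq_smul_one, map_smul, map_one]
  have h00 : ∀ f ∈ I, coeffXY 0 0 f = 0 := fun f hf => by
    by_contra hne
    have := finrank_eq_zero_of_coeffXY_ne_zero hf hne
    omega
  have h01 : ∀ f ∈ I, coeffXY 0 1 f = 0 := fun f hf => by
    by_contra hne
    have := finrank_le_two_of_coeffXY_zero_one_ne_zero hsub hf (h00 f hf) hne
    omega
  by_cases h10 : ∀ f ∈ I, coeffXY 1 0 f = 0
  · obtain ⟨f, hf, h02⟩ := exists_coeffXY_zero_two_ne_zero g h hI hsub h00 h01 h10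
    obtain ⟨e, he⟩ := eq_span_of_coeffXY_zero_two_ne_zero g h hI hsub h00 h01 h10 hf h02
    obtain ⟨φ, hX, hY⟩ := exists_shear_y (e / 2)
    refine ⟨φ, Or.inl ?_⟩
    have hhalf : constXY e = 2 * constXY (e / 2) := by
      rw [← map_ofNat constXY 2, ← map_mul]
      congr 1
      ring
    rw [he, Ideal.map_span, Set.image_pair]
    simp only [RingHom.coe_coe, map_add, map_mul, map_pow, hX, hY, hC]
    rw [hhalf, ← Ideal.span_pair_add_mul_left (Xv ^ 2) (Yv ^ 2) (-(constXY (e / 2) ^ 2))]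
    ring_nf
  · push Not at h10
    obtain ⟨f, hf, h10⟩ := h10
    obtain ⟨d, hd⟩ := eq_span_of_coeffXY_one_zero_ne_zero hsub hdim h00 h01 hf h10
    obtain ⟨φ, hX, hY⟩ := exists_shear_x d
    refine ⟨φ, Or.inr ?_⟩
    rw [hd, Ideal.map_span, Set.image_pair]
    simp only [RingHom.coe_coe, map_add, map_mul, map_pow, hX, hY, hC, sub_add_cancel]

end
end

section
/- Let R = ℂ⟦x,y⟧ and I = ⟨g,h⟩ with g = x² + α·y² + (higher order terms) and h = x·y + β·y² + (higher order terms), such that x² ∈ I and dim_ℂ(R/I) = 4. Then β ≠ 0, and there is an analytic change of coordinates after which I = ⟨x², y²⟩. -/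
/- STATEMENT 2: In R = ℂ⟦x,y⟧, if I = ⟨g,h⟩ with g = x² + α y² + h.o.t. and
h = xy + β y² + h.o.t. (h.o.t. meaning terms in ⟨x,y⟩³), x² ∈ I and
dim_ℂ(R/I) = 4, then β ≠ 0 and after an analytic change of coordinates
I = ⟨x², y²⟩. -/

noncomputable section

noncomputable def mR2 : Ideal R2 := Ideal.span {Xv, Yv}

open MvPowerSeries in
theorem le_order_of_mem_mR2_pow {n : ℕ} {f : R2} (hf : f ∈ mR2 ^ n) : (n : ℕ∞) ≤ f.order := by
  have hm : ∀ p ∈ mR2, (1 : ℕ∞) ≤ order p := by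
    intro p hp
    obtain ⟨a, b, rfl⟩ := Ideal.mem_span_pair.mp hp
    rw [one_le_order_iff_constCoeff_eq_zero]
    simp [Xv, Yv]
  induction hf using Submodule.pow_induction_on_left' with
  | algebraMap r => simp
  | add x y i hx hy ihx ihy => exact (le_min ihx ihy).trans (min_order_le_add ..)
  | mem_mul p hp i x hx ih =>
    refine le_trans ?_ le_order_mul
    push_cast
    rw [add_comm]
    exact add_le_add (hm p hp) ih

open MvPowerSeries in
theorem coeff_mul_of_degree_le_order {f : R2} {d : Fin 2 →₀ ℕ}
    (hf : (d.degree : ℕ∞) ≤ f.order) (a : R2) :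
    coeff d (a * f) = constantCoeff a * coeff d f := by
  classical
  rw [coeff_mul, Finset.sum_eq_single (0, d)]
  · simp
  · rintro ⟨i, j⟩ hij hne
    rw [Finset.HasAntidiagonal.mem_antidiagonal] at hij
    have hi : i ≠ 0 := by
      rintro rfl
      exact hne (by simpa using hij)
    have hdeg : i.degree + j.degree = d.degree := by rw [← hij, map_add]
    have hpos : i.degree ≠ 0 := by rwa [Ne, Finsupp.degree_eq_zero_iff]
    have hlt : (j.degree : ℕ∞) < f.order :=
      lt_of_lt_of_le (by exact_mod_cast (by lia : j.degree < d.degree)) hf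
    simp [coeff_of_lt_order hlt]
  · simp

/-- The exponent of the monomial `x ^ i * y ^ j`. -/
def expo (i j : ℕ) : Fin 2 →₀ ℕ := Finsupp.single 0 i + Finsupp.single 1 j

theorem expo_inj {i j k l : ℕ} : expo i j = expo k l ↔ i = k ∧ j = l := by
  refine ⟨fun h => ⟨?_, ?_⟩, fun ⟨h₁, h₂⟩ => by rw [h₁, h₂]⟩
  · simpa [expo] using DFunLike.congr_fun h 0
  · simpa [expo] using DFunLike.congr_fun h 1

theorem degree_expo (i j : ℕ) : (expo i j).degree = i + j := by
  simp [expo]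

theorem Xv_pow_mul_Yv_pow (i j : ℕ) :
    Xv ^ i * Yv ^ j = MvPowerSeries.monomial (expo i j) 1 := by
  simp [Xv, Yv, MvPowerSeries.X_pow_eq, MvPowerSeries.monomial_mul_monomial, expo]

open MvPowerSeries in
theorem coeff_expo_Xv_pow_mul_Yv_pow (i j k l : ℕ) :
    coeff (expo i j) (Xv ^ k * Yv ^ l) = if i = k ∧ j = l then 1 else 0 := by
  classical
  rw [Xv_pow_mul_Yv_pow, coeff_monomial]
  simp only [expo_inj]

open MvPowerSeries in
theorem coeff_expo_of_mem_mR2_pow {n i j : ℕ} {f : R2} (hf : f ∈ mR2 ^ n) (hij : i + j < n) :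
    coeff (expo i j) f = 0 :=
  coeff_of_lt_order (lt_of_lt_of_le (by rw [degree_expo]; exact_mod_cast hij)
    (le_order_of_mem_mR2_pow hf))

theorem Xv_mem_mR2 : Xv ∈ mR2 := Ideal.subset_span (by simp)

theorem Yv_mem_mR2 : Yv ∈ mR2 := Ideal.subset_span (by simp)

theorem quadratic_mem_mR2_sq (a b c : ℂ) :
    a • Xv ^ 2 + b • (Xv * Yv) + c • Yv ^ 2 ∈ mR2 ^ 2 := by
  have hx := Xv_mem_mR2
  have hy := Yv_mem_mR2
  simp only [pow_two]
  exact add_mem (add_mem (Submodule.smul_of_tower_mem _ a (Ideal.mul_mem_mul hx hx))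
    (Submodule.smul_of_tower_mem _ b (Ideal.mul_mem_mul hx hy)))
    (Submodule.smul_of_tower_mem _ c (Ideal.mul_mem_mul hy hy))

theorem mem_mR2_sq_of_sub_mem {a b c : ℂ} {f : R2}
    (hf : f - (a • Xv ^ 2 + b • (Xv * Yv) + c • Yv ^ 2) ∈ mR2 ^ 3) : f ∈ mR2 ^ 2 := by
  have := add_mem (Ideal.pow_le_pow_right (by norm_num : 2 ≤ 3) hf) (quadratic_mem_mR2_sq a b c)
  simpa using this

open MvPowerSeries in
theorem coeff_of_sub_quadratic_mem {a b c : ℂ} {f : R2}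
    (hf : f - (a • Xv ^ 2 + b • (Xv * Yv) + c • Yv ^ 2) ∈ mR2 ^ 3) :
    coeff (expo 2 0) f = a ∧ coeff (expo 1 1) f = b ∧ coeff (expo 0 2) f = c := by
  have h20 := coeff_expo_of_mem_mR2_pow (i := 2) (j := 0) hf (by norm_num)
  have h11 := coeff_expo_of_mem_mR2_pow (i := 1) (j := 1) hf (by norm_num)
  have h02 := coeff_expo_of_mem_mR2_pow (i := 0) (j := 2) hf (by norm_num)
  have e1 : Xv ^ 2 = Xv ^ 2 * Yv ^ 0 := by simp
  have e2 : Xv * Yv = Xv ^ 1 * Yv ^ 1 := by simp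
  have e3 : Yv ^ 2 = Xv ^ 0 * Yv ^ 2 := by simp
  rw [e1, e2, e3] at h20 h11 h02
  simp only [map_sub, map_add, coeff_smul, coeff_expo_Xv_pow_mul_Yv_pow] at h20 h11 h02
  norm_num at h20 h11 h02
  exact ⟨sub_eq_zero.mp h20, sub_eq_zero.mp h11, sub_eq_zero.mp h02⟩

open MvPowerSeries in
/-- For `f` of order two whose quadratic part is divisible by `x`, the `y³`-coefficient of a
multiple of `f` depends only on the constant term of the multiplier. -/
theorem coeff_mul_of_quadratic_dvd {a b : ℂ} {f : R2}
    (hf : f - (a • Xv ^ 2 + b • (Xv * Yv) + (0 : ℂ) • Yv ^ 2) ∈ mR2 ^ 3) (p : R2) :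
    coeff (expo 0 3) (p * f) = constantCoeff p * coeff (expo 0 3) f := by
  have hdvd : ∀ q : R2,
      coeff (expo 0 3) (q * (a • Xv ^ 2 + b • (Xv * Yv) + (0 : ℂ) • Yv ^ 2)) = 0 := by
    intro q
    refine (X_dvd_iff (s := (0 : Fin 2))).mp ?_ _ (by simp [expo])
    refine ⟨q * (a • Xv + b • Yv), ?_⟩
    change _ = Xv * _
    simp only [Algebra.smul_def, map_zero]
    ring
  have h := coeff_mul_of_degree_le_order (d := expo 0 3)
    (by rw [degree_expo]; exact le_order_of_mem_mR2_pow hf) p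
  have h1 := hdvd 1
  rw [one_mul] at h1
  rwa [mul_sub, map_sub, map_sub, hdvd p, h1, sub_zero, sub_zero] at h

open MvPowerSeries in
/-- If the quadratic parts of `g` and `h` are `x²` and `xy`, then `1, x, y, y², y³` are linearly
independent modulo `⟨g, h⟩`. -/
theorem five_le_finrank_quotient {g h : R2}
    (hg : g - ((1 : ℂ) • Xv ^ 2 + (0 : ℂ) • (Xv * Yv) + (0 : ℂ) • Yv ^ 2) ∈ mR2 ^ 3)
    (hh : h - ((0 : ℂ) • Xv ^ 2 + (1 : ℂ) • (Xv * Yv) + (0 : ℂ) • Yv ^ 2) ∈ mR2 ^ 3)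
    [Module.Finite ℂ (R2 ⧸ Ideal.span {g, h})] :
    5 ≤ Module.finrank ℂ (R2 ⧸ Ideal.span {g, h}) := by
  classical
  let L : R2 →ₗ[ℂ] Fin 5 → ℂ := LinearMap.pi ![coeff (expo 0 0), coeff (expo 1 0),
    coeff (expo 0 1), coeff (expo 0 2), coeff (expo 0 3)
      - coeff (expo 0 3) g • coeff (expo 2 0) - coeff (expo 0 3) h • coeff (expo 1 1)]
  have hg2 := mem_mR2_sq_of_sub_mem hg
  have hh2 := mem_mR2_sq_of_sub_mem hh
  obtain ⟨g20, g11, g02⟩ := coeff_of_sub_quadratic_mem hg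
  obtain ⟨h20, h11, h02⟩ := coeff_of_sub_quadratic_mem hh
  have hL : (Ideal.span {g, h}).restrictScalars ℂ ≤ LinearMap.ker L := by
    intro f hf
    obtain ⟨a, b, rfl⟩ := Ideal.mem_span_pair.mp hf
    have hI : a * g + b * h ∈ mR2 ^ 2 :=
      add_mem (Ideal.mul_mem_left _ _ hg2) (Ideal.mul_mem_left _ _ hh2)
    have hquad : ∀ i j, i + j = 2 → coeff (expo i j) (a * g + b * h) =
        constantCoeff a * coeff (expo i j) g + constantCoeff b * coeff (expo i j) h := by
      intro i j hij
      rw [map_add, coeff_mul_of_degree_le_order, coeff_mul_of_degree_le_order] <;>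
        rw [degree_expo, hij]
      exacts [le_order_of_mem_mR2_pow hh2, le_order_of_mem_mR2_pow hg2]
    rw [LinearMap.mem_ker]
    funext k
    fin_cases k
    · exact coeff_expo_of_mem_mR2_pow hI (by norm_num)
    · exact coeff_expo_of_mem_mR2_pow hI (by norm_num)
    · exact coeff_expo_of_mem_mR2_pow hI (by norm_num)
    · change coeff (expo 0 2) (a * g + b * h) = 0
      rw [hquad 0 2 rfl, g02, h02]
      ring
    · change coeff (expo 0 3) (a * g + b * h)
        - coeff (expo 0 3) g * coeff (expo 2 0) (a * g + b * h)
        - coeff (expo 0 3) h * coeff (expo 1 1) (a * g + b * h) = 0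
      rw [hquad 2 0 rfl, hquad 1 1 rfl, g20, g11, h20, h11, map_add,
        coeff_mul_of_quadratic_dvd hg, coeff_mul_of_quadratic_dvd hh]
      ring
  have hsurj : Function.Surjective L := by
    intro v
    refine ⟨monomial (expo 0 0) (v 0) + monomial (expo 1 0) (v 1) + monomial (expo 0 1) (v 2)
      + monomial (expo 0 2) (v 3) + monomial (expo 0 3) (v 4), ?_⟩
    funext k
    fin_cases k <;> simp [L, coeff_monomial, expo_inj]
  let L' : (R2 ⧸ Ideal.span {g, h}) →ₗ[ℂ] Fin 5 → ℂ :=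
    ((Ideal.span {g, h}).restrictScalars ℂ).liftQ L hL ∘ₗ
      (Submodule.Quotient.restrictScalarsEquiv ℂ (Ideal.span {g, h})).symm.toLinearMap
  have hsurj' : Function.Surjective L' := by
    intro v
    obtain ⟨f, rfl⟩ := hsurj v
    exact ⟨Submodule.Quotient.mk f, rfl⟩
  simpa using LinearMap.finrank_le_finrank_of_surjective hsurj'

open MvPowerSeries in
theorem mR2_le_jacobson : mR2 ≤ Ideal.jacobson (⊥ : Ideal R2) := by
  rw [IsLocalRing.jacobson_eq_maximalIdeal _ bot_ne_top, mR2, Ideal.span_le]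
  rintro f (rfl | rfl) <;>
    simp [IsLocalRing.mem_maximalIdeal, mem_nonunits_iff, isUnit_iff_constantCoeff, Xv, Yv]

theorem mR2_pow_three_eq :
    mR2 ^ 3 = Ideal.span {Xv ^ 3, Xv ^ 2 * Yv, Xv * Yv ^ 2, Yv ^ 3} := by
  rw [pow_succ, pow_two, mR2, Ideal.span_pair_mul_span_pair, Ideal.span_mul_span']
  congr 1
  ext f
  simp only [Set.mem_mul, Set.mem_insert_iff, Set.mem_singleton_iff]
  constructor
  · rintro ⟨a, rfl | rfl | rfl | rfl, b, rfl | rfl, rfl⟩ <;> ring_nf <;> simp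
  · rintro (rfl | rfl | rfl | rfl)
    · exact ⟨_, .inl rfl, _, .inl rfl, by ring⟩
    · exact ⟨_, .inl rfl, _, .inr rfl, by ring⟩
    · exact ⟨_, .inr (.inl rfl), _, .inr rfl, by ring⟩
    · exact ⟨_, .inr (.inr (.inr rfl)), _, .inr rfl, by ring⟩

/-- If `β ≠ 0` the quadrics `x²` and `xy + β y²` generate every cubic form, with linear
coefficients. -/
theorem mR2_pow_three_le {β : ℂ} (hβ : β ≠ 0) :
    mR2 ^ 3 ≤ mR2 * Ideal.span {Xv ^ 2, Xv * Yv + β • Yv ^ 2} := by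
  have hx := Xv_mem_mR2
  have hy := Yv_mem_mR2
  have hp : Xv ^ 2 ∈ Ideal.span {Xv ^ 2, Xv * Yv + β • Yv ^ 2} := Ideal.subset_span (by simp)
  have hq : Xv * Yv + β • Yv ^ 2 ∈ Ideal.span {Xv ^ 2, Xv * Yv + β • Yv ^ 2} :=
    Ideal.subset_span (by simp)
  have hC : algebraMap ℂ R2 β * algebraMap ℂ R2 β⁻¹ = 1 := by
    rw [← map_mul, mul_inv_cancel₀ hβ, map_one]
  have hxyy : Xv * Yv ^ 2 ∈ mR2 * Ideal.span {Xv ^ 2, Xv * Yv + β • Yv ^ 2} := by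
    have := Ideal.mul_mem_left _ (algebraMap ℂ R2 β⁻¹)
      (sub_mem (Ideal.mul_mem_mul hx hq) (Ideal.mul_mem_mul hy hp))
    convert this using 1
    rw [Algebra.smul_def]
    linear_combination (-(Xv * Yv ^ 2)) * hC
  rw [mR2_pow_three_eq, Ideal.span_le]
  rintro f (rfl | rfl | rfl | rfl)
  · simpa [pow_succ, mul_comm, mul_assoc] using Ideal.mul_mem_mul hx hp
  · simpa [mul_comm] using Ideal.mul_mem_mul hy hp
  · exact hxyy
  · have := Ideal.mul_mem_left _ (algebraMap ℂ R2 β⁻¹)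
      (sub_mem (Ideal.mul_mem_mul hy hq) hxyy)
    rw [SetLike.mem_coe]
    convert this using 1
    rw [Algebra.smul_def]
    linear_combination (-(Yv ^ 3)) * hC

/-- An ideal generated by perturbations of `x²` and `xy + β y²` containing `x²` is generated by
these quadrics themselves. -/
theorem span_eq_span_quadrics {β : ℂ} (hβ : β ≠ 0) {g h : R2} (hg : g - Xv ^ 2 ∈ mR2 ^ 3)
    (hh : h - (Xv * Yv + β • Yv ^ 2) ∈ mR2 ^ 3) (hx2 : Xv ^ 2 ∈ Ideal.span {g, h}) :
    Ideal.span {g, h} = Ideal.span {Xv ^ 2, Xv * Yv + β • Yv ^ 2} := by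
  have hcube := mR2_pow_three_le hβ
  have hcube' : mR2 ^ 3 ≤ Ideal.span {Xv ^ 2, Xv * Yv + β • Yv ^ 2} :=
    hcube.trans Ideal.mul_le_right
  apply le_antisymm
  · rw [Ideal.span_le]
    rintro f (rfl | rfl)
    · rw [← sub_add_cancel f (Xv ^ 2)]
      exact Ideal.add_mem _ (hcube' hg) (Ideal.subset_span (.inl rfl))
    · rw [← sub_add_cancel f (Xv * Yv + β • Yv ^ 2)]
      exact Ideal.add_mem _ (hcube' hh) (Ideal.subset_span (.inr rfl))
  · refine Submodule.le_of_le_smul_of_le_jacobson_bot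
      (Submodule.fg_span (by simp)) mR2_le_jacobson ?_
    rw [Ideal.span_le]
    rintro f (rfl | rfl)
    · exact Submodule.mem_sup_left hx2
    · have hmem : h - (h - (Xv * Yv + β • Yv ^ 2)) ∈ Ideal.span {g, h} ⊔
          mR2 • Ideal.span {Xv ^ 2, Xv * Yv + β • Yv ^ 2} :=
        sub_mem (Submodule.mem_sup_left (Ideal.subset_span (.inr rfl)))
          (Submodule.mem_sup_right (hcube hh))
      rwa [sub_sub_cancel] at hmem

open MvPowerSeries in
theorem hasSubst_shear (t : ℂ) : HasSubst (![Xv, Yv + t • Xv] : Fin 2 → R2) :=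
  hasSubst_of_constantCoeff_zero fun s => by fin_cases s <;> simp [Xv, Yv]

/-- The endomorphism of `ℂ⟦x, y⟧` fixing `x` and sending `y` to `y + t x`. -/
def shear (t : ℂ) : R2 →ₐ[ℂ] R2 := MvPowerSeries.substAlgHom (hasSubst_shear t)

theorem shear_Xv (t : ℂ) : shear t Xv = Xv :=
  MvPowerSeries.substAlgHom_X (hasSubst_shear t) 0

theorem shear_Yv (t : ℂ) : shear t Yv = Yv + t • Xv :=
  MvPowerSeries.substAlgHom_X (hasSubst_shear t) 1

open MvPowerSeries in
theorem shear_comp_shear_neg (t : ℂ) : (shear t).comp (shear (-t)) = AlgHom.id ℂ R2 := by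
  ext1 f
  have hX : (fun s => subst (![Xv, Yv + t • Xv] : Fin 2 → R2)
      ((![Xv, Yv + (-t) • Xv] : Fin 2 → R2) s)) = (X : Fin 2 → R2) := by
    funext s
    rw [← substAlgHom_apply (hasSubst_shear t)]
    change shear t _ = _
    fin_cases s
    · exact shear_Xv t
    · change shear t (Yv + (-t) • Xv) = Yv
      rw [map_add, map_smul, shear_Xv, shear_Yv]
      simp
  rw [AlgHom.comp_apply, shear, shear, substAlgHom_apply, substAlgHom_apply,
    subst_comp_subst_apply (hasSubst_shear _) (hasSubst_shear _), hX, subst_self]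
  rfl

/-- The coordinate change fixing `x` and sending `y` to `y + t x`. -/
def shearEquiv (t : ℂ) : R2 ≃ₐ[ℂ] R2 :=
  AlgEquiv.ofAlgHom (shear t) (shear (-t)) (shear_comp_shear_neg t)
    (by simpa using shear_comp_shear_neg (-t))

theorem map_shearEquiv_span_quadrics {β : ℂ} (hβ : β ≠ 0) :
    Ideal.map (shearEquiv (-(2 * β)⁻¹) : R2 →+* R2)
      (Ideal.span {Xv ^ 2, Xv * Yv + β • Yv ^ 2}) = Ideal.span {Xv ^ 2, Yv ^ 2} := by
  have hX : (shearEquiv (-(2 * β)⁻¹) : R2 →+* R2) Xv = Xv := shear_Xv _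
  have hY : (shearEquiv (-(2 * β)⁻¹) : R2 →+* R2) Yv = Yv + (-(2 * β)⁻¹) • Xv := shear_Yv _
  have hq : (shearEquiv (-(2 * β)⁻¹) : R2 →+* R2) (Xv * Yv + β • Yv ^ 2)
      = β • Yv ^ 2 + (-(4 * β)⁻¹) • Xv ^ 2 := by
    have hβY : (shearEquiv (-(2 * β)⁻¹) : R2 →+* R2) (β • Yv ^ 2)
        = β • (Yv + (-(2 * β)⁻¹) • Xv) ^ 2 := by
      rw [← hY, ← map_pow]
      exact map_smul (shearEquiv (-(2 * β)⁻¹)) β (Yv ^ 2)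
    have h1 : algebraMap ℂ R2 β * algebraMap ℂ R2 (2 * β)⁻¹ * 2 = 1 := by
      rw [← map_ofNat (algebraMap ℂ R2) 2, ← map_mul, ← map_mul, ← map_one (algebraMap ℂ R2)]
      congr 1
      field_simp
    have h2 : algebraMap ℂ R2 (4 * β)⁻¹ * 2 = algebraMap ℂ R2 (2 * β)⁻¹ := by
      rw [← map_ofNat (algebraMap ℂ R2) 2, ← map_mul]
      congr 1
      field_simp
      norm_num
    rw [map_add, map_mul, hX, hY, hβY]
    simp only [Algebra.smul_def, map_neg]
    rw [← h2] at h1 ⊢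
    linear_combination (-(Xv * Yv) + Xv ^ 2 * algebraMap ℂ R2 (4 * β)⁻¹) * h1
  rw [Ideal.map_span, Set.image_pair, map_pow, hX, hq]
  apply le_antisymm <;> rw [Ideal.span_le]
  · rintro f (rfl | rfl)
    · exact Ideal.subset_span (by simp)
    · exact add_mem (Submodule.smul_of_tower_mem _ _ (Ideal.subset_span (by simp)))
        (Submodule.smul_of_tower_mem _ _ (Ideal.subset_span (by simp)))
  · rintro f (rfl | rfl)
    · exact Ideal.subset_span (by simp)
    · have hmem : β⁻¹ • ((β • Yv ^ 2 + (-(4 * β)⁻¹) • Xv ^ 2) - (-(4 * β)⁻¹) • Xv ^ 2) ∈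
          Ideal.span {Xv ^ 2, β • Yv ^ 2 + (-(4 * β)⁻¹) • Xv ^ 2} :=
        Submodule.smul_of_tower_mem _ _ (sub_mem (Ideal.subset_span (.inr rfl))
          (Submodule.smul_of_tower_mem _ _ (Ideal.subset_span (.inl rfl))))
      rwa [add_sub_cancel_right, smul_smul, inv_mul_cancel₀ hβ, one_smul] at hmem

open MvPowerSeries in
theorem eq_zero_of_Xv_sq_mem {α β : ℂ} {g h : R2}
    (hg : g - ((1 : ℂ) • Xv ^ 2 + (0 : ℂ) • (Xv * Yv) + α • Yv ^ 2) ∈ mR2 ^ 3)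
    (hh : h - ((0 : ℂ) • Xv ^ 2 + (1 : ℂ) • (Xv * Yv) + β • Yv ^ 2) ∈ mR2 ^ 3)
    (hx2 : Xv ^ 2 ∈ Ideal.span {g, h}) : α = 0 := by
  obtain ⟨a, b, hab⟩ := Ideal.mem_span_pair.mp hx2
  obtain ⟨g20, g11, g02⟩ := coeff_of_sub_quadratic_mem hg
  obtain ⟨h20, h11, h02⟩ := coeff_of_sub_quadratic_mem hh
  have hquad : ∀ i j, i + j = 2 → (if i = 2 ∧ j = 0 then (1 : ℂ) else 0) =
      constantCoeff a * coeff (expo i j) g + constantCoeff b * coeff (expo i j) h := by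
    intro i j hij
    rw [← coeff_expo_Xv_pow_mul_Yv_pow, pow_zero, mul_one, ← hab, map_add,
      coeff_mul_of_degree_le_order, coeff_mul_of_degree_le_order] <;>
      rw [degree_expo, hij]
    exacts [le_order_of_mem_mR2_pow (mem_mR2_sq_of_sub_mem hh),
      le_order_of_mem_mR2_pow (mem_mR2_sq_of_sub_mem hg)]
  have e20 := hquad 2 0 rfl
  have e11 := hquad 1 1 rfl
  have e02 := hquad 0 2 rfl
  rw [g20, h20] at e20
  rw [g11, h11] at e11
  rw [g02, h02] at e02
  norm_num at e20 e11 e02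
  rw [← e20, ← e11] at e02
  simpa using e02.symm

theorem statement2 (α β : ℂ) (g h : R2) (I : Ideal R2)
    (hg : g - (Xv ^ 2 + α • Yv ^ 2) ∈ mR2 ^ 3)
    (hh : h - (Xv * Yv + β • Yv ^ 2) ∈ mR2 ^ 3)
    (hI : I = Ideal.span {g, h})
    (hx2 : Xv ^ 2 ∈ I)
    (hdim : Module.finrank ℂ (R2 ⧸ I) = 4) :
    β ≠ 0 ∧ ∃ φ : R2 ≃ₐ[ℂ] R2,
      Ideal.map (φ : R2 →+* R2) I = Ideal.span {Xv ^ 2, Yv ^ 2} := by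
  subst hI
  have hg' : g - ((1 : ℂ) • Xv ^ 2 + (0 : ℂ) • (Xv * Yv) + α • Yv ^ 2) ∈ mR2 ^ 3 := by
    simpa only [one_smul, zero_smul, add_zero] using hg
  have hh' : h - ((0 : ℂ) • Xv ^ 2 + (1 : ℂ) • (Xv * Yv) + β • Yv ^ 2) ∈ mR2 ^ 3 := by
    simpa only [one_smul, zero_smul, zero_add] using hh
  obtain rfl := eq_zero_of_Xv_sq_mem hg' hh' hx2
  have hβ : β ≠ 0 := by
    rintro rfl
    have : Module.Finite ℂ (R2 ⧸ Ideal.span {g, h}) :=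
      Module.finite_of_finrank_pos (by rw [hdim]; norm_num)
    have := five_le_finrank_quotient hg' hh'
    lia
  rw [zero_smul, add_zero] at hg
  refine ⟨hβ, shearEquiv (-(2 * β)⁻¹), ?_⟩
  rw [span_eq_span_quadrics hβ hg hh hx2]
  exact map_shearEquiv_span_quadrics hβ

end
end
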